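/- Let (X,d) be a compact metric space, T : X → X a continuous map, f : X → ℝ continuous with f ≥ 0, and S a non-increasing scale function. Then the scaled pressure equals the scaled pressure with respect to periodic pseudo-orbits: Sdim(X,T,f,S) = PPSdim(X,T,f,S). -/

import Mathlib

open Filter Metric Set Topology

variable {X : Type*}

noncomputable def Spa [MetricSpace X] (T : X → X) (f : X → ℝ) (S : ℝ → ℝ) (n : ℕ)
    (ε : ℝ) : ℝ :=
  sInf { r : ℝ | ∃ F : Finset X,
      (∀ x : X, ∃ y ∈ F, ∀ i < n, dist (T^[i] x) (T^[i] y) ≤ ε) ∧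
      r = ∑ y ∈ F, Real.exp (S ε * ∑ i ∈ Finset.range n, f (T^[i] y)) }

noncomputable def Sdim [MetricSpace X] (T : X → X) (f : X → ℝ) (S : ℝ → ℝ) : ℝ :=
  limsup (fun ε : ℝ =>
      (limsup (fun n : ℕ => Real.log (Spa T f S n ε) / n) atTop) / S ε)
    (nhdsWithin 0 (Set.Ioi 0))

def PPO [MetricSpace X] (T : X → X) (n : ℕ) (α : ℝ) : Set (ℕ → X) :=
  { x | (∀ i, dist (T (x i)) (x (i + 1)) ≤ α) ∧ ∀ k, x (n + k) = x k }

noncomputable def PPOSpa [MetricSpace X] (T : X → X) (f : X → ℝ) (S : ℝ → ℝ) (n : ℕ)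
    (ε α : ℝ) : ℝ :=
  sInf { r : ℝ | ∃ F : Finset (ℕ → X), ↑F ⊆ PPO T n α ∧
      (∀ x ∈ PPO T n α, ∃ y ∈ F, ∀ i < n, dist (x i) (y i) < ε) ∧
      r = ∑ y ∈ F, Real.exp (S ε * ∑ i ∈ Finset.range n, f (y i)) }

noncomputable def PPSdim [MetricSpace X] (T : X → X) (f : X → ℝ) (S : ℝ → ℝ) : ℝ :=
  limsup (fun ε : ℝ =>
      (limsup (fun α : ℝ =>
          limsup (fun n : ℕ => Real.log (PPOSpa T f S n ε α) / n) atTop)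
        (nhdsWithin 0 (Set.Ioi 0))) / S ε)
    (nhdsWithin 0 (Set.Ioi 0))


/-- The sequences in `Y` admit, up to time `n` and scale `δ`, a finite spanning set of arbitrary
sequences whose total weight for the potential `s • f` is at most `B`. -/
def HasCover [MetricSpace X] (f : X → ℝ) (s : ℝ) (Y : Set (ℕ → X)) (n : ℕ) (δ B : ℝ) : Prop :=
  ∃ F : Finset (ℕ → X), (∀ x ∈ Y, ∃ y ∈ F, ∀ i < n, dist (x i) (y i) ≤ δ) ∧
    ∑ y ∈ F, Real.exp (s * ∑ i ∈ Finset.range n, f (y i)) ≤ B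

/-- The set of genuine orbits of `T`. -/
def orbits (T : X → X) : Set (ℕ → X) := { x | ∀ i, x (i + 1) = T (x i) }

lemma eq_iterate_of_mem_orbits {T : X → X} {x : ℕ → X} (hx : x ∈ orbits T) (i : ℕ) :
    x i = T^[i] (x 0) := by
  induction i with
  | zero => rfl
  | succ i ih => rw [hx i, ih, Function.iterate_succ_apply']

lemma iterate_mem_orbits (T : X → X) (z : X) : (fun i => T^[i] z) ∈ orbits T :=
  fun i => Function.iterate_succ_apply' T i z

lemma periodic_extension_mem_PPO [MetricSpace X] {T : X → X} {x : ℕ → X} (hx : x ∈ orbits T)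
    {t : ℕ} {α : ℝ} (hα : 0 ≤ α) (h : dist (x t) (x 0) ≤ α) :
    (fun i => x (i % t)) ∈ PPO T t α := by
  refine ⟨fun i => ?_, fun k => by simp⟩
  change dist (T (x (i % t))) (x ((i + 1) % t)) ≤ α
  rw [← hx (i % t)]
  rcases Nat.eq_zero_or_pos t with rfl | ht
  · simpa using hα
  · rw [← Nat.mod_add_mod]
    have hlt := Nat.mod_lt i ht
    rcases Nat.lt_or_ge (i % t + 1) t with h1 | h1
    · rw [Nat.mod_eq_of_lt h1]
      simpa using hα
    · have h2 : i % t + 1 = t := by omega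
      rw [h2, Nat.mod_self]
      exact h

section Cover

variable [MetricSpace X] {f : X → ℝ} {s δ : ℝ}

lemma HasCover.mono {Y Y' : Set (ℕ → X)} {n n' : ℕ} {δ' B B' : ℝ}
    (hf0 : ∀ x, 0 ≤ f x) (hs : 0 ≤ s) (h : HasCover f s Y n δ B)
    (hY : Y' ⊆ Y) (hn : n' ≤ n) (hδ : δ ≤ δ') (hB : B ≤ B') : HasCover f s Y' n' δ' B' := by
  obtain ⟨F, hF, hFB⟩ := h
  refine ⟨F, fun x hx => ?_, (Finset.sum_le_sum fun y _ => ?_).trans (hFB.trans hB)⟩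
  · obtain ⟨y, hy, hxy⟩ := hF x (hY hx)
    exact ⟨y, hy, fun i hi => (hxy i (hi.trans_le hn)).trans hδ⟩
  · apply Real.exp_le_exp.2
    apply mul_le_mul_of_nonneg_left _ hs
    exact Finset.sum_le_sum_of_subset_of_nonneg (Finset.range_subset_range.2 hn)
      fun i _ _ => hf0 _

lemma HasCover.zero (Y : Set (ℕ → X)) : HasCover f s Y 0 δ 1 := by
  rcases Y.eq_empty_or_nonempty with rfl | ⟨x, -⟩
  · exact ⟨∅, by simp, by simp⟩
  · exact ⟨{x}, by simp, by simp⟩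

lemma HasCover.append {Y Y₁ Y₂ : Set (ℕ → X)} {n₁ n₂ : ℕ} {B₁ B₂ : ℝ}
    (h₁ : HasCover f s Y₁ n₁ δ B₁) (h₂ : HasCover f s Y₂ n₂ δ B₂)
    (hY : ∀ x ∈ Y, (∃ x' ∈ Y₁, ∀ i < n₁, x i = x' i) ∧ (fun i => x (n₁ + i)) ∈ Y₂) :
    HasCover f s Y (n₁ + n₂) δ (B₁ * B₂) := by
  classical
  obtain ⟨F₁, hF₁, hB₁⟩ := h₁
  obtain ⟨F₂, hF₂, hB₂⟩ := h₂
  let c : (ℕ → X) × (ℕ → X) → ℕ → X := fun p i => if i < n₁ then p.1 i else p.2 (i - n₁)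
  refine ⟨(F₁ ×ˢ F₂).image c, fun x hx => ?_, ?_⟩
  · obtain ⟨⟨x', hx', hxx'⟩, hx2⟩ := hY x hx
    obtain ⟨y₁, hy₁, h1⟩ := hF₁ x' hx'
    obtain ⟨y₂, hy₂, h2⟩ := hF₂ _ hx2
    refine ⟨c (y₁, y₂), Finset.mem_image_of_mem _ (Finset.mk_mem_product hy₁ hy₂),
      fun i hi => ?_⟩
    by_cases hi1 : i < n₁
    · simpa [c, hi1, hxx' i hi1] using h1 i hi1
    · have := h2 (i - n₁) (by omega)
      rw [Nat.add_sub_cancel' (not_lt.1 hi1)] at this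
      simpa [c, hi1] using this
  · have hsum : ∀ p : (ℕ → X) × (ℕ → X),
        Real.exp (s * ∑ i ∈ Finset.range (n₁ + n₂), f (c p i)) =
        Real.exp (s * ∑ i ∈ Finset.range n₁, f (p.1 i)) *
          Real.exp (s * ∑ i ∈ Finset.range n₂, f (p.2 i)) := by
      intro p
      rw [Finset.sum_range_add, mul_add, Real.exp_add]
      have h1 : ∑ i ∈ Finset.range n₁, f (c p i) = ∑ i ∈ Finset.range n₁, f (p.1 i) :=
        Finset.sum_congr rfl fun i hi => by simp [c, Finset.mem_range.1 hi]
      have h2 : ∑ i ∈ Finset.range n₂, f (c p (n₁ + i)) = ∑ i ∈ Finset.range n₂, f (p.2 i) := by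
        simp [c]
      rw [h1, h2]
    calc _ ≤ ∑ p ∈ F₁ ×ˢ F₂, Real.exp (s * ∑ i ∈ Finset.range (n₁ + n₂), f (c p i)) :=
          Finset.sum_image_le_of_nonneg
            (f := fun y : ℕ → X => Real.exp (s * ∑ i ∈ Finset.range (n₁ + n₂), f (y i)))
            (fun _ _ => (Real.exp_pos _).le)
      _ = (∑ y ∈ F₁, Real.exp (s * ∑ i ∈ Finset.range n₁, f (y i))) *
          ∑ y ∈ F₂, Real.exp (s * ∑ i ∈ Finset.range n₂, f (y i)) := by
          rw [Finset.sum_mul_sum, Finset.sum_product]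
          simp_rw [hsum]
      _ ≤ B₁ * B₂ := by
          have h0 : ∀ (n : ℕ) (F : Finset (ℕ → X)),
              0 ≤ ∑ y ∈ F, Real.exp (s * ∑ i ∈ Finset.range n, f (y i)) :=
            fun n F => Finset.sum_nonneg fun _ _ => (Real.exp_pos _).le
          exact mul_le_mul hB₁ hB₂ (h0 _ _) ((h0 _ _).trans hB₁)

lemma HasCover.biUnion {ι : Type*} {I : Finset ι} {Y : ι → Set (ℕ → X)} {n : ℕ} {B : ι → ℝ}
    (h : ∀ t ∈ I, HasCover f s (Y t) n δ (B t)) :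
    HasCover f s (⋃ t ∈ I, Y t) n δ (∑ t ∈ I, B t) := by
  classical
  choose! F hF hB using h
  refine ⟨I.biUnion F, fun x hx => ?_, ?_⟩
  · simp only [mem_iUnion] at hx
    obtain ⟨t, ht, hx⟩ := hx
    obtain ⟨y, hy, hxy⟩ := hF t ht x hx
    exact ⟨y, Finset.mem_biUnion.2 ⟨t, ht, hy⟩, hxy⟩
  · refine le_trans ?_ (Finset.sum_le_sum hB)
    rw [← Finset.sum_sigma (f := fun p : (_ : ι) × (ℕ → X) => Real.exp (s * ∑ i ∈ Finset.range n, f (p.2 i)))]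
    have himg : I.biUnion F = (I.sigma F).image Sigma.snd := by
      ext y
      simp
    rw [himg]
    exact Finset.sum_image_le_of_nonneg
      (f := fun y : ℕ → X => Real.exp (s * ∑ i ∈ Finset.range n, f (y i)))
      (fun _ _ => (Real.exp_pos _).le)

lemma exists_hasCover_univ_one [CompactSpace X] (f : X → ℝ) (s : ℝ) (hδ : 0 < δ) :
    ∃ M : ℝ, 1 ≤ M ∧ HasCover f s univ 1 δ M := by
  classical
  obtain ⟨D, -, hDfin, hD⟩ := finite_cover_balls_of_compact (isCompact_univ (X := X)) hδ
  refine ⟨_, le_max_left 1 _, hDfin.toFinset.image fun z _ => z, fun x _ => ?_, le_max_right _ _⟩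
  obtain ⟨z, hz, hxz⟩ := mem_iUnion₂.1 (hD (mem_univ (x 0)))
  refine ⟨fun _ => z, Finset.mem_image_of_mem _ (hDfin.mem_toFinset.2 hz), fun i hi => ?_⟩
  obtain rfl : i = 0 := by omega
  exact (mem_ball.1 hxz).le

lemma HasCover.pow {Y : Set (ℕ → X)} {m : ℕ} {B : ℝ} (h : HasCover f s Y m δ B)
    (hY : ∀ x ∈ Y, (fun i => x (m + i)) ∈ Y) (q : ℕ) : HasCover f s Y (m * q) δ (B ^ q) := by
  induction q with
  | zero => simpa using HasCover.zero Y
  | succ q ih =>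
    rw [pow_succ', Nat.mul_succ, Nat.add_comm]
    exact h.append ih fun x hx => ⟨⟨x, hx, fun _ _ => rfl⟩, hY x hx⟩

/-- Recentre a cover: the spanning set can be taken inside `Y` at the cost of doubling the scale
and of the oscillation of the potential. -/
lemma HasCover.recenter {Y : Set (ℕ → X)} {n : ℕ} {B w s' : ℝ}
    (hf0 : ∀ x, 0 ≤ f x) (h : HasCover f s Y n δ B)
    (hw : ∀ a b, dist a b ≤ δ → f a ≤ f b + w) (hs' : s' ≤ s) (hs : 0 ≤ s) :
    ∃ F : Finset (ℕ → X), ↑F ⊆ Y ∧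
      (∀ x ∈ Y, ∃ y ∈ F, ∀ i < n, dist (x i) (y i) ≤ 2 * δ) ∧
      ∑ y ∈ F, Real.exp (s' * ∑ i ∈ Finset.range n, f (y i)) ≤ Real.exp (n * (s * w)) * B := by
  classical
  obtain ⟨F, hF, hB⟩ := h
  let F₀ := F.filter fun y => ∃ x ∈ Y, ∀ i < n, dist (x i) (y i) ≤ δ
  have hc : ∀ y ∈ F₀, ∃ x ∈ Y, ∀ i < n, dist (x i) (y i) ≤ δ :=
    fun y hy => (Finset.mem_filter.1 hy).2
  by_cases hne : Nonempty (ℕ → X)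
  swap
  · rw [not_nonempty_iff] at hne
    refine ⟨∅, by simp, fun x => hne.elim x, ?_⟩
    rw [Finset.sum_empty]
    exact mul_nonneg (Real.exp_pos _).le
      ((Finset.sum_nonneg fun _ _ => (Real.exp_pos _).le).trans hB)
  choose! g hgY hg using hc
  refine ⟨F₀.image g, ?_, fun x hx => ?_, ?_⟩
  · intro x hx
    obtain ⟨y, hy, rfl⟩ := Finset.mem_image.1 (Finset.mem_coe.1 hx)
    exact hgY y hy
  · obtain ⟨y, hy, hxy⟩ := hF x hx
    have hy0 : y ∈ F₀ := Finset.mem_filter.2 ⟨hy, x, hx, hxy⟩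
    refine ⟨g y, Finset.mem_image_of_mem _ hy0, fun i hi => ?_⟩
    have h1 := hxy i hi
    have h2 := hg y hy0 i hi
    rw [dist_comm] at h2
    linarith [dist_triangle (x i) (y i) (g y i)]
  · calc _ ≤ ∑ y ∈ F₀, Real.exp (s' * ∑ i ∈ Finset.range n, f (g y i)) :=
          Finset.sum_image_le_of_nonneg
            (f := fun y : ℕ → X => Real.exp (s' * ∑ i ∈ Finset.range n, f (y i)))
            (fun _ _ => (Real.exp_pos _).le)
      _ ≤ ∑ y ∈ F₀, Real.exp (n * (s * w)) *
            Real.exp (s * ∑ i ∈ Finset.range n, f (y i)) := by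
          refine Finset.sum_le_sum fun y hy => ?_
          rw [← Real.exp_add]
          apply Real.exp_le_exp.2
          have h1 : ∑ i ∈ Finset.range n, f (g y i) ≤
              ∑ i ∈ Finset.range n, f (y i) + n * w := by
            calc _ ≤ ∑ i ∈ Finset.range n, (f (y i) + w) :=
                  Finset.sum_le_sum fun i hi => hw _ _ (hg y hy i (Finset.mem_range.1 hi))
              _ = _ := by simp [Finset.sum_add_distrib]
          calc _ ≤ s * ∑ i ∈ Finset.range n, f (g y i) :=
                mul_le_mul_of_nonneg_right hs' (Finset.sum_nonneg fun _ _ => hf0 _)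
            _ ≤ s * (∑ i ∈ Finset.range n, f (y i) + n * w) :=
                mul_le_mul_of_nonneg_left h1 hs
            _ = _ := by ring
      _ ≤ Real.exp (n * (s * w)) * B := by
          rw [← Finset.mul_sum]
          refine mul_le_mul_of_nonneg_left (le_trans ?_ hB) (Real.exp_pos _).le
          exact Finset.sum_le_sum_of_subset_of_nonneg (Finset.filter_subset _ _)
            fun _ _ _ => (Real.exp_pos _).le

lemma HasCover.of_bowen {T : X → X} {n : ℕ} {B : ℝ} {F : Finset X}
    (hF : ∀ x : X, ∃ y ∈ F, ∀ i < n, dist (T^[i] x) (T^[i] y) ≤ δ)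
    (hB : ∑ y ∈ F, Real.exp (s * ∑ i ∈ Finset.range n, f (T^[i] y)) ≤ B) :
    HasCover f s (orbits T) n δ B := by
  classical
  refine ⟨F.image fun y i => T^[i] y, fun x hx => ?_, le_trans ?_ hB⟩
  · obtain ⟨y, hy, hxy⟩ := hF (x 0)
    refine ⟨_, Finset.mem_image_of_mem _ hy, fun i hi => ?_⟩
    rw [eq_iterate_of_mem_orbits hx i]
    exact hxy i hi
  · exact Finset.sum_image_le_of_nonneg
      (f := fun y : ℕ → X => Real.exp (s * ∑ i ∈ Finset.range n, f (y i)))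
      (fun _ _ => (Real.exp_pos _).le)

end Cover

section Spanning

variable [MetricSpace X] {T : X → X} {f : X → ℝ} {S : ℝ → ℝ}

lemma HasCover.exists_spanning_orbits {n : ℕ} {s δ B w ε : ℝ} (hf0 : ∀ x, 0 ≤ f x)
    (h : HasCover f s (orbits T) n δ B) (hw : ∀ a b, dist a b ≤ δ → f a ≤ f b + w)
    (hs' : S ε ≤ s) (hs : 0 ≤ s) (hε : 2 * δ ≤ ε) :
    ∃ F : Finset X, (∀ x : X, ∃ y ∈ F, ∀ i < n, dist (T^[i] x) (T^[i] y) ≤ ε) ∧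
      ∑ y ∈ F, Real.exp (S ε * ∑ i ∈ Finset.range n, f (T^[i] y)) ≤
        Real.exp (n * (s * w)) * B := by
  classical
  obtain ⟨F, hFY, hF, hB⟩ := h.recenter hf0 hw hs' hs
  refine ⟨F.image fun x => x 0, fun x => ?_, le_trans (le_of_eq ?_) hB⟩
  · obtain ⟨y, hy, hxy⟩ := hF _ (iterate_mem_orbits T x)
    refine ⟨y 0, Finset.mem_image_of_mem _ hy, fun i hi => ?_⟩
    rw [← eq_iterate_of_mem_orbits (hFY hy) i]
    exact (hxy i hi).trans hε
  · rw [Finset.sum_image]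
    · refine Finset.sum_congr rfl fun y hy => ?_
      simp_rw [← eq_iterate_of_mem_orbits (hFY hy)]
    · intro x hx y hy hxy
      funext i
      rw [eq_iterate_of_mem_orbits (hFY hx) i, eq_iterate_of_mem_orbits (hFY hy) i]
      exact congrArg _ hxy

lemma HasCover.exists_spanning_PPO {n : ℕ} {s δ B w ε α : ℝ} (hf0 : ∀ x, 0 ≤ f x)
    (h : HasCover f s (PPO T n α) n δ B) (hw : ∀ a b, dist a b ≤ δ → f a ≤ f b + w)
    (hs' : S ε ≤ s) (hs : 0 ≤ s) (hε : 2 * δ < ε) :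
    ∃ F : Finset (ℕ → X), ↑F ⊆ PPO T n α ∧
      (∀ x ∈ PPO T n α, ∃ y ∈ F, ∀ i < n, dist (x i) (y i) < ε) ∧
      ∑ y ∈ F, Real.exp (S ε * ∑ i ∈ Finset.range n, f (y i)) ≤
        Real.exp (n * (s * w)) * B := by
  obtain ⟨F, hFY, hF, hB⟩ := h.recenter hf0 hw hs' hs
  refine ⟨F, hFY, fun x hx => ?_, hB⟩
  obtain ⟨y, hy, hxy⟩ := hF x hx
  exact ⟨y, hy, fun i hi => (hxy i hi).trans_lt hε⟩

lemma bddBelow_of_eq_sum_exp {ι : Type*} {p : Finset ι → Prop} {g : ι → ℝ} :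
    BddBelow { r : ℝ | ∃ F : Finset ι, p F ∧ r = ∑ y ∈ F, Real.exp (g y) } := by
  refine ⟨0, ?_⟩
  rintro r ⟨F, -, rfl⟩
  exact Finset.sum_nonneg fun _ _ => (Real.exp_pos _).le

lemma sInf_sum_exp_nonneg {ι : Type*} {p : Finset ι → Prop} {g : ι → ℝ} :
    0 ≤ sInf { r : ℝ | ∃ F : Finset ι, p F ∧ r = ∑ y ∈ F, Real.exp (g y) } := by
  refine Real.sInf_nonneg ?_
  rintro r ⟨F, -, rfl⟩
  exact Finset.sum_nonneg fun _ _ => (Real.exp_pos _).le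

lemma log_sInf_sum_exp_nonneg {ι : Type*} {p : Finset ι → Prop} {g : ι → ℝ}
    (hg : ∀ y, 0 ≤ g y) :
    0 ≤ Real.log (sInf { r : ℝ | ∃ F : Finset ι, p F ∧ r = ∑ y ∈ F, Real.exp (g y) }) := by
  by_cases h : p ∅
  · have h0 : sInf { r : ℝ | ∃ F : Finset ι, p F ∧ r = ∑ y ∈ F, Real.exp (g y) } ≤ 0 :=
      csInf_le bddBelow_of_eq_sum_exp ⟨∅, h, by simp⟩
    rw [le_antisymm h0 sInf_sum_exp_nonneg, Real.log_zero]
  · by_cases hne : { r : ℝ | ∃ F : Finset ι, p F ∧ r = ∑ y ∈ F, Real.exp (g y) }.Nonempty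
    · refine Real.log_nonneg (le_csInf hne ?_)
      rintro r ⟨F, hF, rfl⟩
      obtain ⟨y, hy⟩ : F.Nonempty := by
        rw [Finset.nonempty_iff_ne_empty]
        rintro rfl
        exact h hF
      exact (Real.one_le_exp (hg y)).trans
        (Finset.single_le_sum (f := fun y => Real.exp (g y)) (fun _ _ => (Real.exp_pos _).le) hy)
    · rw [not_nonempty_iff_eq_empty] at hne
      simp [hne]

lemma log_Spa_nonneg (hf0 : ∀ x, 0 ≤ f x) {ε : ℝ} (hS : 0 ≤ S ε) (n : ℕ) :
    0 ≤ Real.log (Spa T f S n ε) :=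
  log_sInf_sum_exp_nonneg fun _ => mul_nonneg hS (Finset.sum_nonneg fun _ _ => hf0 _)

lemma PPOSpa_eq (n : ℕ) (ε α : ℝ) : PPOSpa T f S n ε α =
    sInf { r : ℝ | ∃ F : Finset (ℕ → X), (↑F ⊆ PPO T n α ∧
      (∀ x ∈ PPO T n α, ∃ y ∈ F, ∀ i < n, dist (x i) (y i) < ε)) ∧
      r = ∑ y ∈ F, Real.exp (S ε * ∑ i ∈ Finset.range n, f (y i)) } := by
  simp only [PPOSpa, and_assoc]

lemma log_PPOSpa_nonneg (hf0 : ∀ x, 0 ≤ f x) {ε : ℝ} (hS : 0 ≤ S ε) (n : ℕ) (α : ℝ) :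
    0 ≤ Real.log (PPOSpa T f S n ε α) := by
  rw [PPOSpa_eq]
  exact log_sInf_sum_exp_nonneg fun _ => mul_nonneg hS (Finset.sum_nonneg fun _ _ => hf0 _)

lemma Spa_nonneg (n : ℕ) (ε : ℝ) : 0 ≤ Spa T f S n ε := sInf_sum_exp_nonneg

lemma PPOSpa_nonneg (n : ℕ) (ε α : ℝ) : 0 ≤ PPOSpa T f S n ε α := by
  rw [PPOSpa_eq]
  exact sInf_sum_exp_nonneg

lemma HasCover.Spa_le {n : ℕ} {s δ B w ε : ℝ} (hf0 : ∀ x, 0 ≤ f x)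
    (h : HasCover f s (orbits T) n δ B) (hw : ∀ a b, dist a b ≤ δ → f a ≤ f b + w)
    (hs' : S ε ≤ s) (hs : 0 ≤ s) (hε : 2 * δ ≤ ε) :
    Spa T f S n ε ≤ Real.exp (n * (s * w)) * B := by
  obtain ⟨F, hF, hB⟩ := h.exists_spanning_orbits hf0 hw hs' hs hε
  exact (csInf_le bddBelow_of_eq_sum_exp ⟨F, hF, rfl⟩).trans hB

lemma HasCover.PPOSpa_le {n : ℕ} {s δ B w ε α : ℝ} (hf0 : ∀ x, 0 ≤ f x)
    (h : HasCover f s (PPO T n α) n δ B) (hw : ∀ a b, dist a b ≤ δ → f a ≤ f b + w)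
    (hs' : S ε ≤ s) (hs : 0 ≤ s) (hε : 2 * δ < ε) :
    PPOSpa T f S n ε α ≤ Real.exp (n * (s * w)) * B := by
  obtain ⟨F, hFY, hF, hB⟩ := h.exists_spanning_PPO hf0 hw hs' hs hε
  rw [PPOSpa_eq]
  exact (csInf_le bddBelow_of_eq_sum_exp ⟨F, ⟨hFY, hF⟩, rfl⟩).trans hB

end Spanning

section Growth

lemma tendsto_log_div_add (K b : ℝ) (k : ℕ) :
    Tendsto (fun n : ℕ => (Real.log K + k * Real.log (n + 1)) / n + b) atTop (𝓝 b) := by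
  have h1 : Tendsto (fun n : ℕ => Real.log K / n) atTop (𝓝 0) :=
    tendsto_const_div_atTop_nhds_zero_nat _
  have h2 : Tendsto (fun n : ℕ => Real.log ((n : ℝ) + 1) / n) atTop (𝓝 0) := by
    have h3 := Real.isLittleO_log_id_atTop.tendsto_div_nhds_zero
    have h4 : Tendsto (fun n : ℕ => (n : ℝ) + 1) atTop atTop :=
      tendsto_atTop_add_const_right _ _ tendsto_natCast_atTop_atTop
    have h5 : Tendsto (fun n : ℕ => 1 + 1 / (n : ℝ)) atTop (𝓝 (1 + 0)) :=
      tendsto_const_nhds.add (tendsto_const_div_atTop_nhds_zero_nat 1)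
    have h6 := (h3.comp h4).mul h5
    rw [zero_mul] at h6
    refine h6.congr' ?_
    filter_upwards [eventually_ge_atTop 1] with n hn
    have : (0 : ℝ) < n := by exact_mod_cast hn
    simp only [Function.comp, id]
    field_simp
  have h7 := (h1.add (h2.const_mul (k : ℝ))).add_const b
  rw [mul_zero, add_zero, zero_add] at h7
  exact h7.congr fun n => by ring

variable {P : ℕ → ℝ} {K b : ℝ} {k : ℕ}

lemma log_div_le (hP0 : ∀ n, 0 ≤ P n) (hK : 1 ≤ K) (hb : 0 ≤ b)
    (hP : ∀ n : ℕ, P n ≤ K * ((n : ℝ) + 1) ^ k * Real.exp (n * b)) :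
    ∀ᶠ n : ℕ in atTop,
      Real.log (P n) / n ≤ (Real.log K + k * Real.log ((n : ℝ) + 1)) / n + b := by
  filter_upwards [eventually_ge_atTop 1] with n hn
  have hn0 : (0 : ℝ) < n := by exact_mod_cast hn
  have hlog : Real.log (P n) ≤ Real.log K + k * Real.log ((n : ℝ) + 1) + n * b := by
    rcases (hP0 n).eq_or_lt with h | h
    · rw [← h, Real.log_zero]
      have := Real.log_nonneg hK
      have := Real.log_nonneg (by linarith : (1 : ℝ) ≤ (n : ℝ) + 1)
      positivity
    · have hKpos : 0 < K := by linarith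
      refine (Real.log_le_log h (hP n)).trans (le_of_eq ?_)
      rw [Real.log_mul (by positivity) (Real.exp_pos _).ne', Real.log_exp,
        Real.log_mul hKpos.ne' (by positivity), Real.log_pow]
  rw [div_add' _ _ _ hn0.ne', div_le_div_iff_of_pos_right hn0]
  linarith

lemma isBoundedUnder_log_div (hP0 : ∀ n, 0 ≤ P n) (hK : 1 ≤ K) (hb : 0 ≤ b)
    (hP : ∀ n : ℕ, P n ≤ K * ((n : ℝ) + 1) ^ k * Real.exp (n * b)) :
    IsBoundedUnder (· ≤ ·) atTop (fun n : ℕ => Real.log (P n) / n) :=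
  (tendsto_log_div_add K b k).isBoundedUnder_le.mono_le (log_div_le hP0 hK hb hP)

lemma isCoboundedUnder_of_nonneg {ι : Type*} {l : Filter ι} [l.NeBot] {u : ι → ℝ}
    (h : ∀ᶠ i in l, 0 ≤ u i) : IsCoboundedUnder (· ≤ ·) l u :=
  IsBoundedUnder.isCoboundedUnder_le ⟨0, h⟩

lemma limsup_nonneg {ι : Type*} {l : Filter ι} [l.NeBot] {u : ι → ℝ}
    (h : ∀ᶠ i in l, 0 ≤ u i) : 0 ≤ limsup u l := by
  refine Real.sInf_nonneg fun a ha => ?_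
  obtain ⟨i, hi, hi'⟩ := (h.and ha).exists
  exact hi.trans hi'

lemma limsup_log_div_le (hP0 : ∀ n, 0 ≤ P n) (hPlog : ∀ n, 0 ≤ Real.log (P n))
    (hK : 1 ≤ K) (hb : 0 ≤ b)
    (hP : ∀ n : ℕ, P n ≤ K * ((n : ℝ) + 1) ^ k * Real.exp (n * b)) :
    limsup (fun n : ℕ => Real.log (P n) / n) atTop ≤ b := by
  rw [← (tendsto_log_div_add K b k).limsup_eq]
  exact limsup_le_limsup (log_div_le hP0 hK hb hP)
    (isCoboundedUnder_of_nonneg (Eventually.of_forall fun n =>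
      div_nonneg (hPlog n) n.cast_nonneg))
    (tendsto_log_div_add K b k).isBoundedUnder_le

lemma eventually_lt_exp_of_limsup_lt (hP0 : ∀ n, 0 ≤ P n)
    (hbdd : IsBoundedUnder (· ≤ ·) atTop (fun n : ℕ => Real.log (P n) / n))
    (h : limsup (fun n : ℕ => Real.log (P n) / n) atTop < b) :
    ∀ᶠ n : ℕ in atTop, P n < Real.exp (n * b) := by
  filter_upwards [eventually_lt_of_limsup_lt h hbdd, eventually_ge_atTop 1] with n hn hn1
  have hn0 : (0 : ℝ) < n := by exact_mod_cast hn1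
  rcases (hP0 n).eq_or_lt with h0 | h0
  · rw [← h0]
    exact Real.exp_pos _
  · rw [div_lt_iff₀ hn0, mul_comm] at hn
    exact (Real.log_lt_iff_lt_exp h0).1 hn

lemma tendsto_const_mul_nhdsGT_zero {c : ℝ} (hc : 0 < c) :
    Tendsto (fun ε : ℝ => c * ε) (𝓝[>] 0) (𝓝[>] 0) := by
  refine tendsto_nhdsWithin_of_tendsto_nhds_of_eventually_within _ ?_ ?_
  · have : Tendsto (fun ε : ℝ => c * ε) (𝓝 0) (𝓝 (c * 0)) := tendsto_id.const_mul _
    rw [mul_zero] at this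
    exact this.mono_left nhdsWithin_le_nhds
  · filter_upwards [self_mem_nhdsWithin] with ε hε
    exact mul_pos hc hε

/-- Comparison of upper limits at `0` up to a change of scale; unbounded functions, whose real
`limsup` is `0` by convention, are treated separately in `limsup_eq_of_rescale_le`. -/
lemma limsup_le_of_rescale_le {u v r : ℝ → ℝ} {c : ℝ} (hc : 0 < c)
    (hu : ∀ᶠ ε in 𝓝[>] (0 : ℝ), 0 ≤ u ε) (hr : Tendsto r (𝓝[>] 0) (𝓝 1))
    (h : ∀ w > 0, ∀ᶠ ε in 𝓝[>] (0 : ℝ), u (c * ε) ≤ r ε * (v ε + w))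
    (hbdd : IsBoundedUnder (· ≤ ·) (𝓝[>] (0 : ℝ)) v) :
    IsBoundedUnder (· ≤ ·) (𝓝[>] (0 : ℝ)) u ∧
      limsup u (𝓝[>] (0 : ℝ)) ≤ limsup v (𝓝[>] (0 : ℝ)) := by
  have key : ∀ b, limsup v (𝓝[>] (0 : ℝ)) < b → ∀ᶠ ε in 𝓝[>] (0 : ℝ), u ε ≤ b := by
    intro b hb
    obtain ⟨b₁, hb₁, hb₂⟩ := exists_between hb
    set w := (b - b₁) / 2 with hw
    have hw0 : 0 < w := by rw [hw]; linarith
    have hlim : Tendsto (fun ε => r ε * (b₁ + w)) (𝓝[>] 0) (𝓝 (1 * (b₁ + w))) :=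
      hr.mul_const _
    have hlt : ∀ᶠ ε in 𝓝[>] (0 : ℝ), r ε * (b₁ + w) < b :=
      hlim.eventually_lt_const (by rw [hw]; linarith)
    have hev : ∀ᶠ ε in 𝓝[>] (0 : ℝ), u (c * ε) ≤ b := by
      filter_upwards [hlt, h w hw0, eventually_lt_of_limsup_lt hb₁ hbdd,
        hr.eventually_const_lt zero_lt_one] with ε h1 h2 h3 h4
      refine h2.trans (le_trans ?_ h1.le)
      exact mul_le_mul_of_nonneg_left (by linarith) h4.le
    filter_upwards [(tendsto_const_mul_nhdsGT_zero (inv_pos.2 hc)).eventually hev] with ε hε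
    rwa [mul_inv_cancel_left₀ hc.ne'] at hε
  refine ⟨⟨_, key _ (lt_add_one _)⟩, le_of_forall_gt_imp_ge_of_dense fun b hb => ?_⟩
  exact limsup_le_of_le (isCoboundedUnder_of_nonneg hu) (key b hb)

lemma limsup_eq_zero_of_not_isBoundedUnder {ι : Type*} {l : Filter ι} {u : ι → ℝ}
    (h : ¬ IsBoundedUnder (· ≤ ·) l u) : limsup u l = 0 := by
  have : {a | ∀ᶠ i in l, u i ≤ a} = ∅ :=
    eq_empty_of_forall_notMem fun a ha => h ⟨a, ha⟩
  rw [limsup_eq, this, Real.sInf_empty]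

lemma limsup_eq_of_rescale_le {u v r r' : ℝ → ℝ} {c c' : ℝ} (hc : 0 < c) (hc' : 0 < c')
    (hu : ∀ᶠ ε in 𝓝[>] (0 : ℝ), 0 ≤ u ε) (hv : ∀ᶠ ε in 𝓝[>] (0 : ℝ), 0 ≤ v ε)
    (hr : Tendsto r (𝓝[>] 0) (𝓝 1)) (hr' : Tendsto r' (𝓝[>] 0) (𝓝 1))
    (huv : ∀ w > 0, ∀ᶠ ε in 𝓝[>] (0 : ℝ), u (c * ε) ≤ r ε * (v ε + w))
    (hvu : ∀ w > 0, ∀ᶠ ε in 𝓝[>] (0 : ℝ), v (c' * ε) ≤ r' ε * (u ε + w)) :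
    limsup u (𝓝[>] (0 : ℝ)) = limsup v (𝓝[>] (0 : ℝ)) := by
  by_cases hbv : IsBoundedUnder (· ≤ ·) (𝓝[>] (0 : ℝ)) v
  · obtain ⟨hbu, hle⟩ := limsup_le_of_rescale_le hc hu hr huv hbv
    exact hle.antisymm (limsup_le_of_rescale_le hc' hv hr' hvu hbu).2
  · have hbu : ¬ IsBoundedUnder (· ≤ ·) (𝓝[>] (0 : ℝ)) u := fun hbu =>
      hbv (limsup_le_of_rescale_le hc' hv hr' hvu hbu).1
    rw [limsup_eq_zero_of_not_isBoundedUnder hbu, limsup_eq_zero_of_not_isBoundedUnder hbv]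

end Growth

section Dynamics

variable [MetricSpace X] {T : X → X} {f : X → ℝ} {S : ℝ → ℝ}

lemma eventually_le_add_of_dist_le [CompactSpace X] (hf : Continuous f) {w : ℝ} (hw : 0 < w) :
    ∀ᶠ δ in 𝓝[>] (0 : ℝ), ∀ a b, dist a b ≤ δ → f a ≤ f b + w := by
  obtain ⟨η, hη, h⟩ :=
    Metric.uniformContinuous_iff.1 (CompactSpace.uniformContinuous_of_continuous hf) w hw
  filter_upwards [Ioo_mem_nhdsGT hη] with δ hδ a b hab
  have := h (hab.trans_lt hδ.2)
  rw [Real.dist_eq] at this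
  linarith [(abs_lt.1 this).2]

lemma exists_pseudo_orbit_near [CompactSpace X] (hT : Continuous T) (i : ℕ) {ε : ℝ}
    (hε : 0 < ε) : ∃ α₀ > 0, ∀ x : ℕ → X, (∀ j, dist (T (x j)) (x (j + 1)) ≤ α₀) →
      dist (x i) (T^[i] (x 0)) ≤ ε := by
  induction i generalizing ε with
  | zero => exact ⟨1, one_pos, fun x _ => by simpa using hε.le⟩
  | succ i ih =>
    obtain ⟨η, hη, h⟩ := Metric.uniformContinuous_iff.1
      (CompactSpace.uniformContinuous_of_continuous hT) (ε / 2) (half_pos hε)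
    obtain ⟨α₀, hα₀, hx⟩ := ih (half_pos hη)
    refine ⟨min α₀ (ε / 2), lt_min hα₀ (half_pos hε), fun x hxα => ?_⟩
    have h1 := h ((hx x fun j => (hxα j).trans (min_le_left _ _)).trans_lt (half_lt_self hη))
    have h2 := (hxα i).trans (min_le_right _ _)
    rw [dist_comm] at h2
    rw [Function.iterate_succ_apply']
    linarith [dist_triangle (x (i + 1)) (T (x i)) (T (T^[i] (x 0)))]

lemma exists_pseudo_orbit_shadow [CompactSpace X] (hT : Continuous T) (m : ℕ) {ε : ℝ}
    (hε : 0 < ε) : ∃ α₀ > 0, ∀ x : ℕ → X, (∀ j, dist (T (x j)) (x (j + 1)) ≤ α₀) →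
      ∀ i < m, dist (x i) (T^[i] (x 0)) ≤ ε := by
  induction m with
  | zero => exact ⟨1, one_pos, by simp⟩
  | succ m ih =>
    obtain ⟨α₁, hα₁, h₁⟩ := ih
    obtain ⟨α₂, hα₂, h₂⟩ := exists_pseudo_orbit_near hT m hε
    refine ⟨min α₁ α₂, lt_min hα₁ hα₂, fun x hx i hi => ?_⟩
    rcases Nat.lt_succ_iff_lt_or_eq.1 hi with hi | rfl
    · exact h₁ x (fun j => (hx j).trans (min_le_left _ _)) i hi
    · exact h₂ x fun j => (hx j).trans (min_le_right _ _)

lemma HasCover.thicken {s δ δ' B : ℝ} {Y Y' : Set (ℕ → X)} {n : ℕ} (h : HasCover f s Y n δ B)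
    (hY : ∀ x ∈ Y', ∃ x' ∈ Y, ∀ i < n, dist (x i) (x' i) ≤ δ') :
    HasCover f s Y' n (δ' + δ) B := by
  obtain ⟨F, hF, hB⟩ := h
  refine ⟨F, fun x hx => ?_, hB⟩
  obtain ⟨x', hx', hxx'⟩ := hY x hx
  obtain ⟨y, hy, hxy⟩ := hF x' hx'
  exact ⟨y, hy, fun i hi =>
    (dist_triangle _ (x' i) _).trans (add_le_add (hxx' i hi) (hxy i hi))⟩

/-- An orbit segment meeting at most `k` cells splits, at the last return to the cell of its
first point, into a periodic pseudo-orbit, one separating point, and a segment meeting at most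
`k - 1` cells. -/
lemma hasCover_orbits_of_PPO {s δ M C b α : ℝ} (hf0 : ∀ x, 0 ≤ f x) (hs : 0 ≤ s) {c : X → X}
    [DecidableEq X] (hα : 0 ≤ α) (hc : ∀ z z', c z = c z' → dist z z' ≤ α)
    (hM : HasCover f s univ 1 δ M) (hM1 : 1 ≤ M) (hC : 1 ≤ C) (hb : 0 ≤ b)
    (hP : ∀ t : ℕ, HasCover f s (PPO T t α) t δ (C * Real.exp (t * b))) (k n : ℕ) :
    HasCover f s {x ∈ orbits T | ((Finset.range n).image fun i => c (x i)).card ≤ k} n δ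
      ((C * M * ((n : ℝ) + 1)) ^ k * Real.exp (n * b)) := by
  have hCM : 1 ≤ C * M := one_le_mul_of_one_le_of_one_le hC hM1
  induction k generalizing n with
  | zero =>
    rcases Nat.eq_zero_or_pos n with rfl | hn
    · simpa using HasCover.zero _
    · refine ⟨∅, fun x hx => ?_, by simpa using (Real.exp_pos _).le⟩
      have h0 := Finset.card_eq_zero.1 (Nat.le_zero.1 hx.2)
      rw [Finset.image_eq_empty, Finset.range_eq_empty_iff] at h0
      omega
  | succ k ih =>
    rcases Nat.eq_zero_or_pos n with rfl | hn
    · refine (HasCover.zero _).mono hf0 hs subset_rfl le_rfl le_rfl ?_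
      simpa using one_le_pow₀ hCM
    let R : ℕ → Set (ℕ → X) := fun n' =>
      {x ∈ orbits T | ((Finset.range n').image fun i => c (x i)).card ≤ k}
    let Y : ℕ → Set (ℕ → X) := fun t =>
      {x ∈ orbits T | dist (x t) (x 0) ≤ α ∧ (fun i => x (t + (1 + i))) ∈ R (n - t - 1)}
    have hY : ∀ t ∈ Finset.range n, HasCover f s (Y t) n δ
        (C * M * (C * M * ((n : ℝ) + 1)) ^ k * Real.exp (n * b)) := by
      intro t ht
      rw [Finset.mem_range] at ht
      have hrest : HasCover f s {x | (fun i => x (1 + i)) ∈ R (n - t - 1)} (1 + (n - t - 1)) δ _ :=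
        hM.append (ih (n - t - 1)) fun x hx => ⟨⟨x, mem_univ _, fun _ _ => rfl⟩, hx⟩
      have hall : HasCover f s (Y t) (t + (1 + (n - t - 1))) δ _ :=
        (hP t).append hrest fun x hx =>
          ⟨⟨_, periodic_extension_mem_PPO hx.1 hα hx.2.1,
            fun i hi => by simp only [Nat.mod_eq_of_lt hi]⟩, hx.2.2⟩
      refine hall.mono hf0 hs subset_rfl (by omega) le_rfl ?_
      have hle : ((n - t - 1 : ℕ) : ℝ) ≤ n := by exact_mod_cast (by omega : n - t - 1 ≤ n)
      have htn : (t : ℝ) + ((n - t - 1 : ℕ) : ℝ) ≤ n := by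
        exact_mod_cast (by omega : t + (n - t - 1) ≤ n)
      calc C * Real.exp (t * b) * (M * ((C * M * (((n - t - 1 : ℕ) : ℝ) + 1)) ^ k *
              Real.exp (((n - t - 1 : ℕ) : ℝ) * b)))
          = C * M * (C * M * (((n - t - 1 : ℕ) : ℝ) + 1)) ^ k *
              Real.exp (((t : ℝ) + ((n - t - 1 : ℕ) : ℝ)) * b) := by
            rw [add_mul, Real.exp_add]
            ring
        _ ≤ _ := by gcongr
    refine (HasCover.biUnion hY).mono hf0 hs ?_ le_rfl le_rfl ?_
    · rintro x ⟨hxo, hx⟩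
      obtain ⟨t, ht, htmax⟩ := ((Finset.range n).filter fun i => c (x i) = c (x 0)).exists_maximal
        ⟨0, by simpa using hn⟩
      rw [Finset.mem_filter, Finset.mem_range] at ht
      refine mem_iUnion₂.2 ⟨t, Finset.mem_range.2 ht.1, hxo, hc _ _ ht.2, ?_, ?_⟩
      · intro i
        exact hxo (t + (1 + i))
      · have hsub : ((Finset.range (n - t - 1)).image fun i => c (x (t + (1 + i)))) ⊆
            ((Finset.range n).image fun i => c (x i)).erase (c (x 0)) := by
          intro z hz
          obtain ⟨i, hi, rfl⟩ := Finset.mem_image.1 hz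
          rw [Finset.mem_range] at hi
          refine Finset.mem_erase.2 ⟨fun h => ?_, Finset.mem_image.2
            ⟨t + (1 + i), Finset.mem_range.2 (by omega), rfl⟩⟩
          have := htmax (y := t + (1 + i))
            (Finset.mem_filter.2 ⟨Finset.mem_range.2 (by omega), h⟩) (by omega)
          omega
        have hmem : c (x 0) ∈ (Finset.range n).image fun i => c (x i) :=
          Finset.mem_image.2 ⟨0, Finset.mem_range.2 hn, rfl⟩
        have h1 := Finset.card_le_card hsub
        rw [Finset.card_erase_of_mem hmem] at h1
        exact h1.trans (Nat.sub_le_of_le_add hx)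
    · rw [Finset.sum_const, Finset.card_range, nsmul_eq_mul, pow_succ]
      have h0 : 0 ≤ C * M * (C * M * ((n : ℝ) + 1)) ^ k * Real.exp (n * b) := by positivity
      nlinarith

lemma exists_hasCover_orbits_of_PPO [CompactSpace X] {s δ C b α : ℝ} (hf0 : ∀ x, 0 ≤ f x)
    (hs : 0 ≤ s) (hδ : 0 < δ) (hα : 0 < α) (hC : 1 ≤ C) (hb : 0 ≤ b)
    (hP : ∀ t : ℕ, HasCover f s (PPO T t α) t δ (C * Real.exp (t * b))) :
    ∃ K : ℝ, 1 ≤ K ∧ ∃ k : ℕ, ∀ n : ℕ,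
      HasCover f s (orbits T) n δ (K * ((n : ℝ) + 1) ^ k * Real.exp (n * b)) := by
  classical
  obtain ⟨M, hM1, hM⟩ := exists_hasCover_univ_one f s hδ
  obtain ⟨D, -, hDfin, hD⟩ := finite_cover_balls_of_compact (isCompact_univ (X := X)) (half_pos hα)
  have hD' : ∀ z : X, ∃ a ∈ D, dist z a < α / 2 := fun z => by
    obtain ⟨a, ha, hza⟩ := mem_iUnion₂.1 (hD (mem_univ z))
    exact ⟨a, ha, hza⟩
  choose c hcD hcd using hD'
  have hc : ∀ z z', c z = c z' → dist z z' ≤ α := fun z z' h => by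
    have h1 := hcd z
    have h2 := hcd z'
    rw [dist_comm, ← h] at h2
    linarith [dist_triangle z (c z) z']
  refine ⟨(C * M) ^ hDfin.toFinset.card,
    one_le_pow₀ (one_le_mul_of_one_le_of_one_le hC hM1), hDfin.toFinset.card, fun n => ?_⟩
  rw [← mul_pow]
  refine (hasCover_orbits_of_PPO hf0 hs hα.le hc hM hM1 hC hb hP hDfin.toFinset.card n).mono
    hf0 hs (fun x hx => ⟨hx, Finset.card_le_card fun z hz => ?_⟩) le_rfl le_rfl le_rfl
  obtain ⟨i, -, rfl⟩ := Finset.mem_image.1 hz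
  exact hDfin.mem_toFinset.2 (hcD _)

lemma exists_hasCover_univ_exp [CompactSpace X] (f : X → ℝ) (s : ℝ) {δ : ℝ} (hδ : 0 < δ) :
    ∃ a : ℝ, 0 ≤ a ∧ ∀ n : ℕ, HasCover f s univ n δ (Real.exp (n * a)) := by
  obtain ⟨M, hM1, hM⟩ := exists_hasCover_univ_one f s hδ
  refine ⟨Real.log M, Real.log_nonneg hM1, fun n => ?_⟩
  rw [Real.exp_nat_mul, Real.exp_log (by linarith)]
  simpa using hM.pow (fun _ _ => mem_univ _) n

lemma exists_le_add_of_compact [CompactSpace X] (hf : Continuous f) (hf0 : ∀ x, 0 ≤ f x) :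
    ∃ w : ℝ, 0 ≤ w ∧ ∀ a b, f a ≤ f b + w := by
  obtain ⟨w, hw⟩ := (isCompact_range hf).bddAbove
  refine ⟨max w 0, le_max_right _ _, fun a b => ?_⟩
  linarith [hw (mem_range_self a), le_max_left w 0, hf0 b]

lemma exists_spanning_bound [CompactSpace X] (hf : Continuous f) (hf0 : ∀ x, 0 ≤ f x) {ε : ℝ}
    (hε : 0 < ε) (hS : 0 ≤ S ε) :
    ∃ a : ℝ, 0 ≤ a ∧
      (∀ n : ℕ, ∃ F : Finset X,
        (∀ x : X, ∃ y ∈ F, ∀ i < n, dist (T^[i] x) (T^[i] y) ≤ ε) ∧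
        ∑ y ∈ F, Real.exp (S ε * ∑ i ∈ Finset.range n, f (T^[i] y)) ≤ Real.exp (n * a)) ∧
      ∀ (α : ℝ) (n : ℕ), ∃ F : Finset (ℕ → X), ↑F ⊆ PPO T n α ∧
        (∀ x ∈ PPO T n α, ∃ y ∈ F, ∀ i < n, dist (x i) (y i) < ε) ∧
        ∑ y ∈ F, Real.exp (S ε * ∑ i ∈ Finset.range n, f (y i)) ≤ Real.exp (n * a) := by
  obtain ⟨a, ha, h⟩ := exists_hasCover_univ_exp f (S ε) (by positivity : 0 < ε / 3)
  obtain ⟨w, hw0, hw⟩ := exists_le_add_of_compact hf hf0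
  have hexp : ∀ n : ℕ, Real.exp (n * (S ε * w + a)) =
      Real.exp (n * (S ε * w)) * Real.exp (n * a) := fun n => by
    rw [← Real.exp_add, mul_add]
  refine ⟨S ε * w + a, by positivity, fun n => ?_, fun α n => ?_⟩
  · rw [hexp]
    exact ((h n).mono hf0 hS (subset_univ _) le_rfl le_rfl le_rfl).exists_spanning_orbits hf0
      (fun x y _ => hw x y) le_rfl hS (by linarith)
  · rw [hexp]
    exact ((h n).mono hf0 hS (subset_univ _) le_rfl le_rfl le_rfl).exists_spanning_PPO hf0
      (fun x y _ => hw x y) le_rfl hS (by linarith)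

lemma exists_Spa_PPOSpa_le_exp [CompactSpace X] (hf : Continuous f) (hf0 : ∀ x, 0 ≤ f x) {ε : ℝ}
    (hε : 0 < ε) (hS : 0 ≤ S ε) :
    ∃ a : ℝ, 0 ≤ a ∧ (∀ n : ℕ, Spa T f S n ε ≤ Real.exp (n * a)) ∧
      ∀ (α : ℝ) (n : ℕ), PPOSpa T f S n ε α ≤ Real.exp (n * a) := by
  obtain ⟨a, ha, h₁, h₂⟩ := exists_spanning_bound (T := T) hf hf0 hε hS
  refine ⟨a, ha, fun n => ?_, fun α n => ?_⟩
  · obtain ⟨F, hF, hB⟩ := h₁ n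
    exact (csInf_le bddBelow_of_eq_sum_exp ⟨F, hF, rfl⟩).trans hB
  · obtain ⟨F, hFY, hF, hB⟩ := h₂ α n
    rw [PPOSpa_eq]
    exact (csInf_le bddBelow_of_eq_sum_exp ⟨F, ⟨hFY, hF⟩, rfl⟩).trans hB

lemma limsup_PPOSpa_nonneg (hf0 : ∀ x, 0 ≤ f x) {ε : ℝ} (hS : 0 ≤ S ε) (α : ℝ) :
    0 ≤ limsup (fun n : ℕ => Real.log (PPOSpa T f S n ε α) / n) atTop :=
  limsup_nonneg (Eventually.of_forall fun n =>
    div_nonneg (log_PPOSpa_nonneg hf0 hS n α) n.cast_nonneg)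

lemma limsup_Spa_nonneg (hf0 : ∀ x, 0 ≤ f x) {ε : ℝ} (hS : 0 ≤ S ε) :
    0 ≤ limsup (fun n : ℕ => Real.log (Spa T f S n ε) / n) atTop :=
  limsup_nonneg (Eventually.of_forall fun n =>
    div_nonneg (log_Spa_nonneg hf0 hS n) n.cast_nonneg)

lemma exists_mul_exp_bound {P : ℕ → ℝ} {b : ℝ} (hP0 : ∀ n, 0 ≤ P n)
    (h : ∀ᶠ n : ℕ in atTop, P n < Real.exp (n * b)) (hb : 0 ≤ b) :
    ∃ C : ℝ, 1 ≤ C ∧ ∀ n : ℕ, P n < C * Real.exp (n * b) := by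
  obtain ⟨N, hN⟩ := eventually_atTop.1 h
  have hsum : 0 ≤ ∑ i ∈ Finset.range N, P i := Finset.sum_nonneg fun i _ => hP0 i
  refine ⟨2 + ∑ i ∈ Finset.range N, P i, by linarith, fun n => ?_⟩
  have hexp : 1 ≤ Real.exp (n * b) := Real.one_le_exp (by positivity)
  rcases lt_or_ge n N with hn | hn
  · have h1 := Finset.single_le_sum (f := P) (fun i _ => hP0 i) (Finset.mem_range.2 hn)
    nlinarith
  · have h1 := hN n hn
    nlinarith

lemma limsup_Spa_le [CompactSpace X] (hf : Continuous f) (hf0 : ∀ x, 0 ≤ f x) {ε w : ℝ}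
    (hε : 0 < ε) (hw0 : 0 ≤ w) (hw : ∀ a b, dist a b ≤ ε → f a ≤ f b + w)
    (hS2 : 0 ≤ S (2 * ε)) (hS : S (2 * ε) ≤ S ε) :
    limsup (fun n : ℕ => Real.log (Spa T f S n (2 * ε)) / n) atTop ≤
      limsup (fun α : ℝ => limsup (fun n : ℕ => Real.log (PPOSpa T f S n ε α) / n) atTop)
        (𝓝[>] 0) + S ε * w := by
  have hS0 : 0 ≤ S ε := hS2.trans hS
  obtain ⟨a, ha, -, hPa⟩ := exists_Spa_PPOSpa_le_exp (T := T) hf hf0 hε hS0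
  obtain ⟨a', -, -, hspan⟩ := exists_spanning_bound (T := T) hf hf0 hε hS0
  have hPa' : ∀ (α : ℝ) (n : ℕ),
      PPOSpa T f S n ε α ≤ 1 * ((n : ℝ) + 1) ^ 0 * Real.exp (n * a) := by simpa using hPa
  have hbdd : IsBoundedUnder (· ≤ ·) (𝓝[>] (0 : ℝ)) fun α : ℝ =>
      limsup (fun n : ℕ => Real.log (PPOSpa T f S n ε α) / n) atTop :=
    ⟨a, eventually_map.2 <| Eventually.of_forall fun α =>
      limsup_log_div_le (fun n => PPOSpa_nonneg n ε α)
        (fun n => log_PPOSpa_nonneg hf0 hS0 n α) le_rfl ha (hPa' α)⟩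
  refine le_of_forall_gt_imp_ge_of_dense fun b' hb' => ?_
  obtain ⟨b, rfl⟩ : ∃ b, b' = S ε * w + b := ⟨b' - S ε * w, by ring⟩
  have hb := (add_comm _ (S ε * w) ▸ hb' : S ε * w + _ < _)
  rw [add_lt_add_iff_left] at hb
  have hb0 : 0 ≤ b := (limsup_nonneg (Eventually.of_forall fun α =>
    limsup_PPOSpa_nonneg hf0 hS0 α)).trans hb.le
  obtain ⟨α, hαb, hα⟩ :=
    ((eventually_lt_of_limsup_lt hb hbdd).and self_mem_nhdsWithin).exists
  obtain ⟨C, hC, hCP⟩ := exists_mul_exp_bound (fun n => PPOSpa_nonneg n ε α)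
    (eventually_lt_exp_of_limsup_lt (fun n => PPOSpa_nonneg n ε α)
      (isBoundedUnder_log_div (fun n => PPOSpa_nonneg n ε α) le_rfl ha (hPa' α)) hαb) hb0
  have hcover : ∀ t : ℕ, HasCover f (S ε) (PPO T t α) t ε (C * Real.exp (t * b)) := by
    intro t
    obtain ⟨F, hFY, hF, -⟩ := hspan α t
    obtain ⟨r, ⟨F', -, hF', rfl⟩, hr⟩ := exists_lt_of_csInf_lt (by exact ⟨_, F, hFY, hF, rfl⟩) (hCP t)
    refine ⟨F', fun x hx => ?_, hr.le⟩
    obtain ⟨y, hy, hxy⟩ := hF' x hx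
    exact ⟨y, hy, fun i hi => (hxy i hi).le⟩
  obtain ⟨K, hK, k, hKk⟩ := exists_hasCover_orbits_of_PPO hf0 hS0 hε hα hC hb0 hcover
  refine limsup_log_div_le (fun n => Spa_nonneg n _) (fun n => log_Spa_nonneg hf0 hS2 n) hK
    (by positivity) (k := k) fun n => ?_
  refine ((hKk n).Spa_le hf0 hw hS hS0 le_rfl).trans (le_of_eq ?_)
  rw [mul_add, Real.exp_add]
  ring

lemma limsup_PPOSpa_le [CompactSpace X] (hT : Continuous T) (hf : Continuous f)
    (hf0 : ∀ x, 0 ≤ f x) {ε w : ℝ}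
    (hε : 0 < ε) (hw0 : 0 ≤ w) (hw : ∀ a b, dist a b ≤ 2 * ε → f a ≤ f b + w)
    (hS5 : 0 ≤ S (5 * ε)) (hS : S (5 * ε) ≤ S ε) :
    limsup (fun α : ℝ => limsup (fun n : ℕ => Real.log (PPOSpa T f S n (5 * ε) α) / n) atTop)
        (𝓝[>] 0) ≤
      limsup (fun n : ℕ => Real.log (Spa T f S n ε) / n) atTop + S ε * w := by
  have hS0 : 0 ≤ S ε := hS5.trans hS
  obtain ⟨a, ha, hPa, -⟩ := exists_Spa_PPOSpa_le_exp (T := T) hf hf0 hε hS0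
  obtain ⟨a', -, hspan, -⟩ := exists_spanning_bound (T := T) hf hf0 hε hS0
  have hPa' : ∀ n : ℕ,
      Spa T f S n ε ≤ 1 * ((n : ℝ) + 1) ^ 0 * Real.exp (n * a) := by simpa using hPa
  refine le_of_forall_gt_imp_ge_of_dense fun b' hb' => ?_
  obtain ⟨b, rfl⟩ : ∃ b, b' = S ε * w + b := ⟨b' - S ε * w, by ring⟩
  have hb := (add_comm _ (S ε * w) ▸ hb' : S ε * w + _ < _)
  rw [add_lt_add_iff_left] at hb
  have hb0 : 0 ≤ b := (limsup_Spa_nonneg hf0 hS0).trans hb.le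
  obtain ⟨m, hm, hm1⟩ := ((eventually_lt_exp_of_limsup_lt (fun n => Spa_nonneg n ε)
    (isBoundedUnder_log_div (fun n => Spa_nonneg n ε) le_rfl ha hPa') hb).and
    (eventually_ge_atTop 1)).exists
  obtain ⟨F, hF, -⟩ := hspan m
  obtain ⟨r, ⟨F', hF', rfl⟩, hr⟩ := exists_lt_of_csInf_lt (by exact ⟨_, F, hF, rfl⟩) hm
  have horb : HasCover f (S ε) (orbits T) m ε (Real.exp (m * b)) := HasCover.of_bowen hF' hr.le
  obtain ⟨α₀, hα₀, hshadow⟩ := exists_pseudo_orbit_shadow hT m hε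
  have hpo : HasCover f (S ε) {x : ℕ → X | ∀ j, dist (T (x j)) (x (j + 1)) ≤ α₀} m (ε + ε)
      (Real.exp (m * b)) :=
    horb.thicken fun x hx => ⟨_, iterate_mem_orbits T (x 0), hshadow x hx⟩
  have hPn : ∀ α ≤ α₀, ∀ n : ℕ, PPOSpa T f S n (5 * ε) α ≤
      Real.exp (m * b) * ((n : ℝ) + 1) ^ 0 * Real.exp (n * (S ε * w + b)) := by
    intro α hα n
    have hq : n ≤ m * (n / m + 1) := (Nat.lt_mul_div_succ n hm1).le
    have hcov : HasCover f (S ε) (PPO T n α) n (2 * ε) (Real.exp (m * b) ^ (n / m + 1)) :=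
      (hpo.pow (fun x hx j => hx (m + j)) (n / m + 1)).mono hf0 hS0
        (fun x hx j => (hx.1 j).trans hα) hq (by linarith) le_rfl
    refine (hcov.PPOSpa_le hf0 hw hS hS0 (by linarith)).trans ?_
    rw [← Real.exp_nat_mul, pow_zero, mul_one, ← Real.exp_add, ← Real.exp_add]
    apply Real.exp_le_exp.2
    have h1 : ((n / m : ℕ) : ℝ) * m ≤ n := by exact_mod_cast Nat.div_mul_le_self n m
    push_cast
    nlinarith
  refine limsup_le_of_le (isCoboundedUnder_of_nonneg (Eventually.of_forall fun α =>
    limsup_PPOSpa_nonneg hf0 hS5 α)) ?_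
  filter_upwards [Ioo_mem_nhdsGT hα₀] with α hα
  exact limsup_log_div_le (fun n => PPOSpa_nonneg n _ α)
    (fun n => log_PPOSpa_nonneg hf0 hS5 n α) (Real.one_le_exp (by positivity)) (by positivity)
    (hPn α hα.2.le)

end Dynamics

lemma eventually_rescale_le {g h S : ℝ → ℝ} {c w : ℝ}
    (hgh : ∀ᶠ ε in 𝓝[>] (0 : ℝ), 0 < S ε ∧ 0 < S (c * ε) ∧ g (c * ε) ≤ h ε + S ε * w) :
    ∀ᶠ ε in 𝓝[>] (0 : ℝ),
      g (c * ε) / S (c * ε) ≤ (S (c * ε) / S ε)⁻¹ * (h ε / S ε + w) := by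
  filter_upwards [hgh] with ε ⟨h1, h2, h3⟩
  rw [inv_div, div_le_iff₀ h2]
  refine h3.trans (le_of_eq ?_)
  field_simp

/-- for `f ≥ 0` and a non-increasing scale function `S`, the scaled
pressure equals the scaled pressure with respect to periodic pseudo-orbits. -/
theorem Sdim_eq_PPSdim [MetricSpace X] [CompactSpace X] (T : X → X) (hT : Continuous T)
    (f : X → ℝ) (hf : Continuous f) (hf0 : ∀ x, 0 ≤ f x) (S : ℝ → ℝ)
    (hSpos : ∀ x : ℝ, 0 < x → x < 1 → 0 < S x)
    (hSscale : ∀ l : ℝ, 0 < l →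
      Tendsto (fun x => S (l * x) / S x) (nhdsWithin 0 (Set.Ioi 0)) (nhds 1))
    (hSanti : AntitoneOn S (Set.Ioo 0 1)) :
    Sdim T f S = PPSdim T f S := by
  have hinv : ∀ c : ℝ, 0 < c → Tendsto (fun ε => (S (c * ε) / S ε)⁻¹) (𝓝[>] 0) (𝓝 1) :=
    fun c hc => by simpa using (hSscale c hc).inv₀ one_ne_zero
  have hsmall : ∀ᶠ ε in 𝓝[>] (0 : ℝ), ε ∈ Ioo (0 : ℝ) (1 / 5) := Ioo_mem_nhdsGT (by norm_num)
  let G : ℝ → ℝ := fun ε => limsup (fun n : ℕ => Real.log (Spa T f S n ε) / n) atTop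
  let H : ℝ → ℝ := fun ε => limsup (fun α : ℝ =>
    limsup (fun n : ℕ => Real.log (PPOSpa T f S n ε α) / n) atTop) (𝓝[>] 0)
  change limsup (fun ε => G ε / S ε) (𝓝[>] 0) = limsup (fun ε => H ε / S ε) (𝓝[>] 0)
  refine limsup_eq_of_rescale_le two_pos (by norm_num : (0 : ℝ) < 5) ?_ ?_ (hinv 2 two_pos)
    (hinv 5 (by norm_num))
    (fun w hw => eventually_rescale_le (g := G) (h := H) (S := S) (c := 2) (w := w) ?_)
    (fun w hw => eventually_rescale_le (g := H) (h := G) (S := S) (c := 5) (w := w) ?_)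
  · filter_upwards [hsmall] with ε ⟨h0, h1⟩
    have hS := (hSpos ε h0 (by linarith)).le
    exact div_nonneg (limsup_Spa_nonneg hf0 hS) hS
  · filter_upwards [hsmall] with ε ⟨h0, h1⟩
    have hS := (hSpos ε h0 (by linarith)).le
    exact div_nonneg (limsup_nonneg (Eventually.of_forall fun α =>
      limsup_PPOSpa_nonneg hf0 hS α)) hS
  · filter_upwards [hsmall, eventually_le_add_of_dist_le hf hw] with ε ⟨h0, h1⟩ hε
    have hS2 := hSpos (2 * ε) (by linarith) (by linarith)
    exact ⟨hSpos ε h0 (by linarith), hS2, limsup_Spa_le hf hf0 h0 hw.le hε hS2.le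
      (hSanti ⟨h0, by linarith⟩ ⟨by linarith, by linarith⟩ (by linarith))⟩
  · filter_upwards [hsmall,
      (tendsto_const_mul_nhdsGT_zero two_pos).eventually (eventually_le_add_of_dist_le hf hw)]
      with ε ⟨h0, h1⟩ hε
    have hS5 := hSpos (5 * ε) (by linarith) (by linarith)
    exact ⟨hSpos ε h0 (by linarith), hS5, limsup_PPOSpa_le hT hf hf0 h0 hw.le hε hS5.le
      (hSanti ⟨h0, by linarith⟩ ⟨by linarith, by linarith⟩ (by linarith))⟩
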